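/- (Uniform convergence of the Fourier series representation.) Let τ > 0, T = Nτ with N ∈ ℕ, K = ⌈T/τ⌉, L > 0, a₁, a₂ > 0, d₁, d₂ ∈ ℝ with (nπa₁/L)² − d₁ > 0 and (nπa₂/L)² − d₂ > 0 for all positive integers n; set ωₙ = √((nπa₁/L)² − d₁) and υₙ = √((nπa₂/L)² − d₂). Let Φₙ ∈ C¹([−τ,0],ℝ) and Fₙ ∈ C([0,T],ℝ) be sequences of functions, and suppose for some α > 0: (|Φₙ(0)| + |Φₙ'(0)|)·n^{K+3+α} → 0, (max_{−τ≤s≤0}|Φₙ(s)|)·n^{K+3+α} → 0, and (max_{0≤s≤T}|Fₙ(s)|)·n^{K+2+α} → 0 as n → ∞. Define, for t ∈ [0,T], Aₙ(t) = C_τ^{−ωₙ²,−υₙ²}(t)·Φₙ(0) + S_τ^{−ωₙ²,−υₙ²}(t)·Φₙ'(0), Bₙ(t) = −υₙ²·∫_{−τ}^{0} S_τ^{−ωₙ²,−υₙ²}(t−τ−s)·Φₙ(s) ds, and Cₙ(t) = ∫_{0}^{t} S_τ^{−ωₙ²,−υₙ²}(t−s)·Fₙ(s) ds. Then the series Σ_{n=1}^∞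 (Aₙ(t) + Bₙ(t) + Cₙ(t))·sin(nπx/L) converges absolutely and uniformly on [0,T]×[0,L]. -/

import Mathlib

/-- Single term of the double series defining the delayed perturbation cosine function. -/
noncomputable def Cterm (τ a b t : ℝ) (k m : ℕ) : ℝ :=
  if k ≤ m then
    (m.choose k : ℝ) * a ^ (m - k) * b ^ k * (max (t - (k : ℝ) * τ) 0) ^ (2 * m) /
      (Nat.factorial (2 * m) : ℝ)
  else 0

/-- Single term of the double series defining the delayed perturbation sine function. -/
noncomputable def Sterm (τ a b t : ℝ) (k m : ℕ) : ℝ :=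
  if k ≤ m then
    (m.choose k : ℝ) * a ^ (m - k) * b ^ k * (max (t - (k : ℝ) * τ) 0) ^ (2 * m + 1) /
      (Nat.factorial (2 * m + 1) : ℝ)
  else 0

/-- The delayed perturbation cosine-type function `C_τ^{a,b}`, extended by `0` for `t < 0`. -/
noncomputable def Cdel (τ a b : ℝ) (t : ℝ) : ℝ :=
  if t < 0 then 0 else ∑' k : ℕ, ∑' m : ℕ, Cterm τ a b t k m

/-- The delayed perturbation sine-type function `S_τ^{a,b}`, extended by `0` for `t < 0`. -/
noncomputable def Sdel (τ a b : ℝ) (t : ℝ) : ℝ :=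
  if t < 0 then 0 else ∑' k : ℕ, ∑' m : ℕ, Sterm τ a b t k m

/-- The exponential generating function of the sequence `d`. -/
noncomputable def egf (d : ℕ → ℝ) (s : ℝ) : ℝ :=
  ∑' n : ℕ, d n * s ^ n / (n.factorial : ℝ)

lemma egf_zero (d : ℕ → ℝ) : egf d 0 = d 0 := by
  unfold egf
  rw [tsum_eq_single 0]
  · simp
  · intro n hn
    simp [hn]

lemma summable_egf {d : ℕ → ℝ} {A R : ℝ} (hd : ∀ n, |d n| ≤ A * R ^ n) (s : ℝ) :
    Summable fun n : ℕ => d n * s ^ n / (n.factorial : ℝ) := by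
  refine Summable.of_norm_bounded
    ((Real.summable_pow_div_factorial (R * |s|)).mul_left A) fun n => ?_
  rw [Real.norm_eq_abs, abs_div, abs_mul, abs_pow, Nat.abs_cast, mul_pow, ← mul_div_assoc,
    ← mul_assoc]
  gcongr
  exact hd n

lemma hasDerivAt_egf {d : ℕ → ℝ} {A R : ℝ} (hd : ∀ n, |d n| ≤ A * R ^ n) (s : ℝ) :
    HasDerivAt (egf d) (egf (fun n => d (n + 1)) s) s := by
  have hd' : ∀ n, |d (n + 1)| ≤ A * R * R ^ n := fun n => by
    simpa [pow_succ', mul_assoc] using hd (n + 1)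
  have hshift : ∀ (e : ℕ → ℝ) (x : ℝ) (n : ℕ),
      e (n + 1) * (((n + 1 : ℕ) : ℝ) * x ^ (n + 1 - 1)) / ((n + 1).factorial : ℝ)
        = e (n + 1) * x ^ n / (n.factorial : ℝ) := fun e x n => by
    rw [Nat.factorial_succ, Nat.add_sub_cancel]
    push_cast
    have : (n.factorial : ℝ) ≠ 0 := by positivity
    field_simp
  set ρ : ℝ := |s| + 1
  have hu : Summable fun n : ℕ => |d n| * ((n : ℝ) * ρ ^ (n - 1)) / (n.factorial : ℝ) := by
    rw [← summable_nat_add_iff 1]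
    simp only [hshift fun n => |d n|]
    exact summable_egf (d := fun n => |d (n + 1)|) (fun n => by rw [abs_abs]; exact hd' n) ρ
  have key := hasDerivAt_tsum_of_isPreconnected (t := Metric.ball (0 : ℝ) ρ)
    (g := fun n x => d n * x ^ n / (n.factorial : ℝ))
    (g' := fun n x => d n * ((n : ℝ) * x ^ (n - 1)) / (n.factorial : ℝ)) (y₀ := 0) (y := s)
    hu Metric.isOpen_ball (convex_ball _ _).isPreconnected
    (fun n x _ => ((hasDerivAt_pow n x).const_mul (d n)).div_const _)
    (fun n x hx => by
      rw [mem_ball_zero_iff, Real.norm_eq_abs] at hx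
      rw [Real.norm_eq_abs, abs_div, abs_mul, abs_mul, abs_pow, Nat.abs_cast, Nat.abs_cast]
      gcongr)
    (by rw [mem_ball_zero_iff, norm_zero]; positivity) (summable_egf hd 0)
    (by rw [mem_ball_zero_iff, Real.norm_eq_abs]; exact lt_add_one _)
  have hval : ∑' n : ℕ, d n * ((n : ℝ) * s ^ (n - 1)) / (n.factorial : ℝ)
      = egf (fun n => d (n + 1)) s := by
    rw [tsum_eq_zero_add']
    · simp only [hshift d s]
      simp [egf]
    · simp only [hshift d s]
      exact summable_egf hd' s
  rw [hval] at key
  exact key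

/-- A priori bound for a forced harmonic oscillator. -/
lemma abs_le_of_oscillator {g g' g'' : ℝ → ℝ} {w s H : ℝ} (hs : 0 ≤ s) (hw : 0 < w)
    (hg : ∀ x, HasDerivAt g (g' x) x) (hg' : ∀ x, HasDerivAt g' (g'' x) x)
    (hH : ∀ x ∈ Set.Icc 0 s, |g'' x + w ^ 2 * g x| ≤ H) :
    w * |g s| ≤ |g' 0| + w * |g 0| + H * s := by
  set W : ℝ → ℝ := fun x => g' x * Real.sin (w * (s - x)) + w * g x * Real.cos (w * (s - x))
    with hW
  have hlin : ∀ x, HasDerivAt (fun x => w * (s - x)) (-w) x := fun x => by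
    simpa using ((hasDerivAt_id x).const_sub s).const_mul w
  have hderiv : ∀ x, HasDerivAt W ((g'' x + w ^ 2 * g x) * Real.sin (w * (s - x))) x := fun x => by
    refine (((hg' x).mul (hlin x).sin).add (((hg x).const_mul w).mul (hlin x).cos)).congr_deriv ?_
    ring
  have h := norm_image_sub_le_of_norm_deriv_le_segment' (f := W) (a := 0) (b := s) (C := H)
    (fun x _ => (hderiv x).hasDerivWithinAt)
    (fun x hx => by
      rw [Real.norm_eq_abs, abs_mul]
      calc _ ≤ |g'' x + w ^ 2 * g x| * 1 := by gcongr; exact Real.abs_sin_le_one _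
        _ ≤ H := by rw [mul_one]; exact hH x ⟨hx.1, hx.2.le⟩)
    s ⟨hs, le_rfl⟩
  have hWs : W s = w * g s := by simp [hW]
  have hW0 : |W 0| ≤ |g' 0| + w * |g 0| := by
    calc |W 0| ≤ |g' 0| * |Real.sin (w * (s - 0))| + w * |g 0| * |Real.cos (w * (s - 0))| := by
          refine (abs_add_le _ _).trans_eq ?_
          rw [abs_mul, abs_mul, abs_mul, abs_of_pos hw]
      _ ≤ |g' 0| * 1 + w * |g 0| * 1 := by
          gcongr
          · exact Real.abs_sin_le_one _
          · exact Real.abs_cos_le_one _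
      _ = _ := by ring
  rw [Real.norm_eq_abs, hWs, sub_zero] at h
  have h' := abs_sub_abs_le_abs_sub (w * g s) (W 0)
  rw [abs_mul, abs_of_pos hw] at h'
  linarith

/-- The coefficient `binom(m,k) a^(m-k) b^k`. -/
noncomputable def binomCoeff (a b : ℝ) (k m : ℕ) : ℝ :=
  (m.choose k : ℝ) * a ^ (m - k) * b ^ k

lemma binomCoeff_zero_succ (a b : ℝ) (m : ℕ) :
    binomCoeff a b 0 (m + 1) = a * binomCoeff a b 0 m := by
  simp [binomCoeff, pow_succ']

lemma binomCoeff_succ_succ (a b : ℝ) (k m : ℕ) :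
    binomCoeff a b (k + 1) (m + 1) = a * binomCoeff a b (k + 1) m + b * binomCoeff a b k m := by
  unfold binomCoeff
  rw [Nat.choose_succ_succ, Nat.add_sub_add_right]
  rcases lt_or_ge m (k + 1) with h | h
  · rw [Nat.choose_eq_zero_of_lt h]
    push_cast
    ring
  · obtain ⟨j, rfl⟩ := Nat.exists_eq_add_of_le h
    rw [show k + 1 + j - k = j + 1 by lia, show k + 1 + j - (k + 1) = j by lia]
    push_cast
    ring

lemma abs_binomCoeff_le (a b : ℝ) (k m : ℕ) : |binomCoeff a b k m| ≤ (|a| + |b|) ^ m := by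
  unfold binomCoeff
  rcases lt_or_ge m k with h | h
  · rw [Nat.choose_eq_zero_of_lt h]
    simp only [Nat.cast_zero, zero_mul, abs_zero]
    positivity
  · rw [add_comm |a|, add_pow, abs_mul, abs_mul, abs_pow, abs_pow, Nat.abs_cast]
    refine le_trans (le_of_eq ?_) (Finset.single_le_sum
      (f := fun i => |b| ^ i * |a| ^ (m - i) * (m.choose i : ℝ)) (fun i _ => by positivity)
      (Finset.mem_range.2 (Nat.lt_succ_of_le h)))
    ring

/-- The coefficients `binomCoeff a b k m` placed at the indices `2 * m + r`. -/
noncomputable def spreadCoeff (r : ℕ) (a b : ℝ) (k n : ℕ) : ℝ :=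
  if n % 2 = r then binomCoeff a b k (n / 2) else 0

lemma spreadCoeff_zero_add_two (r : ℕ) (a b : ℝ) (n : ℕ) :
    spreadCoeff r a b 0 (n + 2) = a * spreadCoeff r a b 0 n := by
  unfold spreadCoeff
  rw [Nat.add_mod_right, Nat.add_div_right _ two_pos, binomCoeff_zero_succ]
  split_ifs <;> simp

lemma spreadCoeff_succ_add_two (r : ℕ) (a b : ℝ) (k n : ℕ) :
    spreadCoeff r a b (k + 1) (n + 2)
      = a * spreadCoeff r a b (k + 1) n + b * spreadCoeff r a b k n := by
  unfold spreadCoeff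
  rw [Nat.add_mod_right, Nat.add_div_right _ two_pos, binomCoeff_succ_succ]
  split_ifs <;> simp

lemma abs_spreadCoeff_le (r : ℕ) (a b : ℝ) (k n : ℕ) :
    |spreadCoeff r a b k n| ≤ 1 * (|a| + |b| + 1) ^ n := by
  have h0 : 0 ≤ |a| + |b| := by positivity
  unfold spreadCoeff
  rw [one_mul]
  split_ifs
  · calc |binomCoeff a b k (n / 2)| ≤ (|a| + |b|) ^ (n / 2) := abs_binomCoeff_le a b k _
      _ ≤ (|a| + |b| + 1) ^ (n / 2) := pow_le_pow_left₀ h0 (by linarith) _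
      _ ≤ (|a| + |b| + 1) ^ n := pow_le_pow_right₀ (by linarith) (Nat.div_le_self n 2)
  · rw [abs_zero]
    positivity

lemma abs_spreadCoeff_le_one (r : ℕ) (a b : ℝ) (k : ℕ) {n : ℕ} (hn : n < 2) :
    |spreadCoeff r a b k n| ≤ 1 := by
  unfold spreadCoeff
  rw [Nat.div_eq_of_lt hn]
  split_ifs
  · simpa using abs_binomCoeff_le a b k 0
  · simp

lemma tsum_eq_egf_spreadCoeff {r : ℕ} (hr : r < 2) (a b s : ℝ) (k : ℕ) :
    ∑' m : ℕ, (if k ≤ m then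
      (m.choose k : ℝ) * a ^ (m - k) * b ^ k * s ^ (2 * m + r) /
        (Nat.factorial (2 * m + r) : ℝ) else 0) = egf (spreadCoeff r a b k) s := by
  have hsupp : Function.support (fun n : ℕ => spreadCoeff r a b k n * s ^ n / (n.factorial : ℝ))
      ⊆ Set.range fun m : ℕ => 2 * m + r := fun n hn => by
    refine ⟨n / 2, ?_⟩
    by_contra h
    have h' : n % 2 ≠ r := fun h' => h (by simp only; lia)
    exact hn (by simp [spreadCoeff, h'])
  rw [egf, ← Function.Injective.tsum_eq (fun x y h => by simpa using h) hsupp]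
  refine tsum_congr fun m => ?_
  have h1 : (2 * m + r) % 2 = r := by lia
  have h2 : (2 * m + r) / 2 = m := by lia
  simp only [spreadCoeff, h1, h2, if_true, binomCoeff]
  split_ifs with h
  · rfl
  · rw [Nat.choose_eq_zero_of_lt (not_le.1 h)]
    simp

lemma egf_linear_comb {d e : ℕ → ℝ} {A R : ℝ} (hd : ∀ n, |d n| ≤ A * R ^ n)
    (he : ∀ n, |e n| ≤ A * R ^ n) (a b s : ℝ) :
    egf (fun n => a * d n + b * e n) s = a * egf d s + b * egf e s := by
  unfold egf
  rw [← tsum_mul_left, ← tsum_mul_left,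
    ← ((summable_egf hd s).mul_left a).tsum_add ((summable_egf he s).mul_left b)]
  exact tsum_congr fun n => by ring

lemma mul_abs_egf_spreadCoeff_le (r : ℕ) {w b s H : ℝ} (hs : 0 ≤ s) (hw : 0 < w) (k : ℕ)
    (hH : ∀ x ∈ Set.Icc 0 s, |egf (fun n => spreadCoeff r (-w ^ 2) b k (n + 2)) x
      + w ^ 2 * egf (spreadCoeff r (-w ^ 2) b k) x| ≤ H) :
    w * |egf (spreadCoeff r (-w ^ 2) b k) s| ≤ 1 + w + H * s := by
  have hd := abs_spreadCoeff_le r (-w ^ 2) b k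
  have hd' : ∀ n, |spreadCoeff r (-w ^ 2) b k (n + 1)|
      ≤ 1 * (|-w ^ 2| + |b| + 1) * (|-w ^ 2| + |b| + 1) ^ n := fun n => by
    simpa [pow_succ', mul_assoc] using hd (n + 1)
  have h := abs_le_of_oscillator hs hw (hasDerivAt_egf hd) (hasDerivAt_egf hd') hH
  rw [egf_zero, egf_zero] at h
  have h0 := abs_spreadCoeff_le_one r (-w ^ 2) b k (n := 0) two_pos
  have h1 := abs_spreadCoeff_le_one r (-w ^ 2) b k (n := 1) one_lt_two
  simp only [zero_add] at h
  nlinarith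

lemma exists_egf_spreadCoeff_bound (T : ℝ) {q Q : ℝ} (hq : 0 ≤ q) (hQ : 0 ≤ Q) (k : ℕ) :
    ∃ M : ℝ, 0 ≤ M ∧ ∀ w v X : ℝ, 1 ≤ X → 0 < w → 1 ≤ q * w → T * v ^ 2 ≤ Q * X * w →
      ∀ r : ℕ, ∀ s ∈ Set.Icc 0 T,
        |egf (spreadCoeff r (-w ^ 2) (-v ^ 2) k) s| ≤ M * X ^ k := by
  induction k with
  | zero =>
    refine ⟨1 + q, by positivity, fun w v X hX hw hqw _ r s hs => ?_⟩
    have h := mul_abs_egf_spreadCoeff_le r (b := -v ^ 2) (H := 0) hs.1 hw 0 fun x _ => by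
      simp only [spreadCoeff_zero_add_two]
      have := egf_linear_comb (abs_spreadCoeff_le r (-w ^ 2) (-v ^ 2) 0)
        (abs_spreadCoeff_le r (-w ^ 2) (-v ^ 2) 0) (-w ^ 2) 0 x
      simp only [zero_mul, add_zero] at this
      rw [this]
      simp
    refine le_of_mul_le_mul_left (h.trans ?_) hw
    rw [pow_zero]
    linarith
  | succ k ih =>
    obtain ⟨M, hM, ih⟩ := ih
    refine ⟨1 + q + Q * M, by positivity, fun w v X hX hw hqw hQw r s hs => ?_⟩
    have h := mul_abs_egf_spreadCoeff_le r (b := -v ^ 2) (H := v ^ 2 * (M * X ^ k)) hs.1 hw (k + 1)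
      fun x hx => by
        simp only [spreadCoeff_succ_add_two]
        rw [egf_linear_comb (abs_spreadCoeff_le r (-w ^ 2) (-v ^ 2) (k + 1))
          (abs_spreadCoeff_le r (-w ^ 2) (-v ^ 2) k),
          show ∀ y z : ℝ, -w ^ 2 * y + -v ^ 2 * z + w ^ 2 * y = -(v ^ 2 * z) from
            fun y z => by ring, abs_neg, abs_mul, abs_of_nonneg (sq_nonneg v)]
        gcongr
        exact ih w v X hX hw hqw hQw r x ⟨hx.1, hx.2.trans hs.2⟩
    refine le_of_mul_le_mul_left (h.trans ?_) hw
    have hXk : 1 ≤ X ^ (k + 1) := one_le_pow₀ hX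
    have hX0 : 0 ≤ X := by linarith
    calc 1 + w + v ^ 2 * (M * X ^ k) * s
        ≤ q * w + w + v ^ 2 * (M * X ^ k) * T := by
          gcongr
          exact hs.2
      _ = (q * w + w) * 1 + T * v ^ 2 * (M * X ^ k) := by ring
      _ ≤ (q * w + w) * X ^ (k + 1) + Q * X * w * (M * X ^ k) := by gcongr
      _ = w * ((1 + q + Q * M) * X ^ (k + 1)) := by ring

lemma delayed_zero_of_lt {τ t : ℝ} {N k : ℕ} (hτ : 0 < τ) (ht : t ≤ N * τ) (hk : N < k) :
    max (t - (k : ℝ) * τ) 0 = 0 := by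
  have : (N : ℝ) * τ ≤ k * τ := by gcongr
  exact max_eq_right (by linarith)

lemma Cdel_eq_sum {τ t : ℝ} {N : ℕ} (hτ : 0 < τ) (h0 : 0 ≤ t) (ht : t ≤ N * τ) (a b : ℝ) :
    Cdel τ a b t = ∑ k ∈ Finset.range (N + 1),
      egf (spreadCoeff 0 a b k) (max (t - (k : ℝ) * τ) 0) := by
  rw [Cdel, if_neg (not_lt.2 h0), tsum_eq_sum (s := Finset.range (N + 1))]
  · exact Finset.sum_congr rfl fun k _ => tsum_eq_egf_spreadCoeff two_pos a b _ k
  · intro k hk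
    have hk : N < k := by simpa using hk
    refine (tsum_congr fun m => ?_).trans tsum_zero
    rw [Cterm, delayed_zero_of_lt hτ ht hk]
    split_ifs with h
    · rw [zero_pow (by lia)]
      simp
    · rfl

lemma Sdel_eq_sum {τ t : ℝ} {N : ℕ} (hτ : 0 < τ) (h0 : 0 ≤ t) (ht : t ≤ N * τ) (a b : ℝ) :
    Sdel τ a b t = ∑ k ∈ Finset.range (N + 1),
      egf (spreadCoeff 1 a b k) (max (t - (k : ℝ) * τ) 0) := by
  rw [Sdel, if_neg (not_lt.2 h0), tsum_eq_sum (s := Finset.range (N + 1))]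
  · exact Finset.sum_congr rfl fun k _ => tsum_eq_egf_spreadCoeff one_lt_two a b _ k
  · intro k hk
    have hk : N < k := by simpa using hk
    refine (tsum_congr fun m => ?_).trans tsum_zero
    rw [Sterm, delayed_zero_of_lt hτ ht hk]
    simp

/-- The delayed perturbation functions grow at most like the `N`-th power of the frequency on
`(-∞, Nτ]`. -/
lemma exists_delayed_bound {τ q Q : ℝ} (hτ : 0 < τ) (hq : 0 ≤ q) (hQ : 0 ≤ Q) (N : ℕ) :
    ∃ M : ℝ, 0 ≤ M ∧ ∀ w v X : ℝ, 1 ≤ X → 0 < w → 1 ≤ q * w → N * τ * v ^ 2 ≤ Q * X * w →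
      ∀ t ≤ N * τ, |Cdel τ (-w ^ 2) (-v ^ 2) t| ≤ M * X ^ N ∧
        |Sdel τ (-w ^ 2) (-v ^ 2) t| ≤ M * X ^ N := by
  have hT : 0 ≤ N * τ := by positivity
  choose M hM hbound using exists_egf_spreadCoeff_bound (N * τ) hq hQ
  refine ⟨∑ k ∈ Finset.range (N + 1), M k, Finset.sum_nonneg fun k _ => hM k,
    fun w v X hX hw hqw hQw t ht => ?_⟩
  have hX0 : 0 ≤ X := by linarith
  have hsum : ∀ r : ℕ, 0 ≤ t → |∑ k ∈ Finset.range (N + 1),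
      egf (spreadCoeff r (-w ^ 2) (-v ^ 2) k) (max (t - (k : ℝ) * τ) 0)|
        ≤ (∑ k ∈ Finset.range (N + 1), M k) * X ^ N := fun r h0 => by
    rw [Finset.sum_mul]
    refine (Finset.abs_sum_le_sum_abs _ _).trans (Finset.sum_le_sum fun k hk => ?_)
    have hkτ : 0 ≤ (k : ℝ) * τ := by positivity
    refine (hbound k w v X hX hw hqw hQw r _
      ⟨le_max_right _ _, max_le (by linarith) hT⟩).trans ?_
    exact mul_le_mul_of_nonneg_left
      (pow_le_pow_right₀ hX (Nat.lt_succ_iff.1 (Finset.mem_range.1 hk))) (hM k)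
  rcases lt_or_ge t 0 with h0 | h0
  · have : 0 ≤ (∑ k ∈ Finset.range (N + 1), M k) * X ^ N :=
      mul_nonneg (Finset.sum_nonneg fun k _ => hM k) (by positivity)
    simpa [Cdel, Sdel, h0] using this
  · rw [Cdel_eq_sum hτ h0 ht, Sdel_eq_sum hτ h0 ht]
    exact ⟨hsum 0 h0, hsum 1 h0⟩

lemma abs_le_biSup_of_continuousOn {f : ℝ → ℝ} {a b : ℝ} (hf : ContinuousOn f (Set.Icc a b))
    {s : ℝ} (hs : s ∈ Set.Icc a b) : |f s| ≤ ⨆ x ∈ Set.Icc a b, |f x| := by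
  obtain ⟨B, hB⟩ := isCompact_Icc.exists_bound_of_continuousOn hf
  have hB0 : 0 ≤ B := (norm_nonneg _).trans (hB s hs)
  have hbdd : BddAbove (Set.range fun x => ⨆ _ : x ∈ Set.Icc a b, |f x|) := by
    refine ⟨B, ?_⟩
    rintro _ ⟨x, rfl⟩
    exact Real.iSup_le (fun hx => hB x hx) hB0
  exact le_ciSup_of_le hbdd s (ciSup_pos (f := fun _ => |f s|) hs).ge

lemma exists_mul_le_sqrt_sq_sub {p d : ℝ} (hp : 0 < p) (h : 0 < p ^ 2 - d) :
    ∃ c : ℝ, 0 < c ∧ ∀ x : ℝ, 1 ≤ x → c * x ≤ Real.sqrt ((x * p) ^ 2 - d) := by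
  have hc : 0 < min (p ^ 2) (p ^ 2 - d) := lt_min (by positivity) h
  refine ⟨Real.sqrt (min (p ^ 2) (p ^ 2 - d)), Real.sqrt_pos.2 hc, fun x hx => ?_⟩
  have hx2 : 1 ≤ x ^ 2 := one_le_pow₀ hx
  refine Real.le_sqrt_of_sq_le ?_
  rw [mul_pow, Real.sq_sqrt hc.le]
  rcases le_total d 0 with hd | hd
  · have := mul_le_mul_of_nonneg_right (min_le_left (p ^ 2) (p ^ 2 - d)) (by positivity : 0 ≤ x ^ 2)
    nlinarith
  · have := mul_le_mul_of_nonneg_right (min_le_right (p ^ 2) (p ^ 2 - d))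
      (by positivity : 0 ≤ x ^ 2)
    nlinarith

lemma exists_le_of_tendsto_zero {x : ℕ → ℝ} (h : Filter.Tendsto x Filter.atTop (nhds 0)) :
    ∃ D : ℝ, ∀ n, x n ≤ D := by
  obtain ⟨D, hD⟩ := h.bddAbove_range
  exact ⟨D, fun n => hD ⟨n, rfl⟩⟩

/-- uniform convergence of the Fourier series representation: under the
polynomial decay assumptions on the history coefficients `Φₙ` and forcing coefficients
`Fₙ`, the series `Σₙ (Aₙ(t) + Bₙ(t) + Cₙ(t))·sin(nπx/L)` converges absolutely and
uniformly on `[0,T]×[0,L]`. -/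
theorem fourier_series_uniform_convergence (τ : ℝ) (hτ : 0 < τ) (N : ℕ)
    (T : ℝ) (hT : T = (N : ℝ) * τ) (K : ℕ) (hK : K = ⌈T / τ⌉₊)
    (L a₁ a₂ : ℝ) (hL : 0 < L) (ha₁ : 0 < a₁) (ha₂ : 0 < a₂) (d₁ d₂ : ℝ)
    (hpos₁ : ∀ n : ℕ, 0 < n → 0 < ((n : ℝ) * Real.pi * a₁ / L) ^ 2 - d₁)
    (hpos₂ : ∀ n : ℕ, 0 < n → 0 < ((n : ℝ) * Real.pi * a₂ / L) ^ 2 - d₂)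
    (ω υ : ℕ → ℝ)
    (hω : ∀ n : ℕ, ω n = Real.sqrt (((n : ℝ) * Real.pi * a₁ / L) ^ 2 - d₁))
    (hυ : ∀ n : ℕ, υ n = Real.sqrt (((n : ℝ) * Real.pi * a₂ / L) ^ 2 - d₂))
    (Φ F : ℕ → ℝ → ℝ)
    (hΦ : ∀ n : ℕ, ContDiffOn ℝ 1 (Φ n) (Set.Icc (-τ) 0))
    (hF : ∀ n : ℕ, ContinuousOn (F n) (Set.Icc (0 : ℝ) T))
    (α : ℝ) (hα : 0 < α)
    (hdecay₁ : Filter.Tendsto (fun n : ℕ =>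
      (|Φ n 0| + |derivWithin (Φ n) (Set.Icc (-τ) (0 : ℝ)) 0|)
        * (n : ℝ) ^ ((K : ℝ) + 3 + α)) Filter.atTop (nhds 0))
    (hdecay₂ : Filter.Tendsto (fun n : ℕ =>
      (⨆ s ∈ Set.Icc (-τ) (0 : ℝ), |Φ n s|) * (n : ℝ) ^ ((K : ℝ) + 3 + α))
      Filter.atTop (nhds 0))
    (hdecay₃ : Filter.Tendsto (fun n : ℕ =>
      (⨆ s ∈ Set.Icc (0 : ℝ) T, |F n s|) * (n : ℝ) ^ ((K : ℝ) + 2 + α))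
      Filter.atTop (nhds 0))
    (A B C : ℕ → ℝ → ℝ)
    (hA : ∀ n t, A n t = Cdel τ (-(ω n) ^ 2) (-(υ n) ^ 2) t * Φ n 0
      + Sdel τ (-(ω n) ^ 2) (-(υ n) ^ 2) t * derivWithin (Φ n) (Set.Icc (-τ) (0 : ℝ)) 0)
    (hB : ∀ n t, B n t = -(υ n) ^ 2 *
      ∫ s in (-τ)..(0 : ℝ), Sdel τ (-(ω n) ^ 2) (-(υ n) ^ 2) (t - τ - s) * Φ n s)
    (hC : ∀ n t, C n t = ∫ s in (0 : ℝ)..t, Sdel τ (-(ω n) ^ 2) (-(υ n) ^ 2) (t - s) * F n s) :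
    (∀ p : ℝ × ℝ, p ∈ Set.Icc (0 : ℝ) T ×ˢ Set.Icc (0 : ℝ) L →
      Summable (fun n : ℕ =>
        |(A (n + 1) p.1 + B (n + 1) p.1 + C (n + 1) p.1)
          * Real.sin (((n : ℝ) + 1) * Real.pi * p.2 / L)|)) ∧
    TendstoUniformlyOn
      (fun (m : ℕ) (p : ℝ × ℝ) => ∑ n ∈ Finset.range m,
        (A (n + 1) p.1 + B (n + 1) p.1 + C (n + 1) p.1)
          * Real.sin (((n : ℝ) + 1) * Real.pi * p.2 / L))
      (fun p : ℝ × ℝ => ∑' n : ℕ,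
        (A (n + 1) p.1 + B (n + 1) p.1 + C (n + 1) p.1)
          * Real.sin (((n : ℝ) + 1) * Real.pi * p.2 / L))
      Filter.atTop (Set.Icc (0 : ℝ) T ×ˢ Set.Icc (0 : ℝ) L) := by
  have hT0 : 0 ≤ T := by rw [hT]; positivity
  have hKN : K = N := by
    rw [hK, hT, mul_div_assoc, div_self hτ.ne', mul_one, Nat.ceil_natCast]
  have hfreq : ∀ (n : ℕ) (a : ℝ), (n : ℝ) * Real.pi * a / L = n * (Real.pi * a / L) :=
    fun n a => by ring
  simp only [hfreq] at hω hυ hpos₁ hpos₂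
  obtain ⟨c, hc, hcω⟩ := exists_mul_le_sqrt_sq_sub (p := Real.pi * a₁ / L) (d := d₁)
    (by positivity) (by simpa using hpos₁ 1 one_pos)
  set c₂ : ℝ := (Real.pi * a₂ / L) ^ 2 + |d₂|
  have hc₂ : 0 ≤ c₂ := by positivity
  have hυ_le : ∀ n : ℕ, 0 < n → υ n ^ 2 ≤ c₂ * (n : ℝ) ^ 2 := fun n hn => by
    have hX : (1 : ℝ) ≤ (n : ℝ) ^ 2 := one_le_pow₀ (by exact_mod_cast hn)
    rw [hυ, Real.sq_sqrt (hpos₂ n hn).le, mul_pow]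
    have := neg_abs_le d₂
    have := mul_le_mul_of_nonneg_left hX (abs_nonneg d₂)
    simp only [c₂]
    nlinarith
  obtain ⟨M, hM, hbound⟩ := exists_delayed_bound hτ (q := c⁻¹) (Q := T * c₂ / c)
    (by positivity) (by positivity) N
  have hdel : ∀ n : ℕ, 0 < n → ∀ t ≤ T,
      |Cdel τ (-(ω n) ^ 2) (-(υ n) ^ 2) t| ≤ M * (n : ℝ) ^ N ∧
        |Sdel τ (-(ω n) ^ 2) (-(υ n) ^ 2) t| ≤ M * (n : ℝ) ^ N := fun n hn t ht => by
    have hX : (1 : ℝ) ≤ n := by exact_mod_cast hn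
    have hωn : c * n ≤ ω n := by rw [hω]; exact hcω n hX
    refine hbound (ω n) (υ n) n hX (lt_of_lt_of_le (by positivity) hωn) ?_ ?_ t (hT ▸ ht)
    · rw [inv_mul_eq_div, one_le_div hc]
      nlinarith
    · rw [← hT]
      calc T * υ n ^ 2 ≤ T * (c₂ * (n : ℝ) ^ 2) := by gcongr; exact hυ_le n hn
        _ = T * c₂ / c * n * (c * n) := by field_simp
        _ ≤ T * c₂ / c * n * ω n := by gcongr
  obtain ⟨D₁, hD₁⟩ := exists_le_of_tendsto_zero hdecay₁
  obtain ⟨D₂, hD₂⟩ := exists_le_of_tendsto_zero hdecay₂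
  obtain ⟨D₃, hD₃⟩ := exists_le_of_tendsto_zero hdecay₃
  set G : ℝ := M * D₁ + c₂ * M * τ * D₂ + M * T * D₃
  have hcoef : ∀ n : ℕ, 0 < n → ∀ t ∈ Set.Icc 0 T,
      |A n t + B n t + C n t| ≤ G * ((n : ℝ) ^ (1 + α))⁻¹ := fun n hn t ht => by
    have hX : (1 : ℝ) ≤ n := by exact_mod_cast hn
    have hX0 : (0 : ℝ) < n := by linarith
    have hY : 0 < (n : ℝ) ^ (1 + α) := Real.rpow_pos_of_pos hX0 _
    have hpow₃ : (n : ℝ) ^ ((K : ℝ) + 3 + α) = (n : ℝ) ^ N * (n : ℝ) ^ 2 * (n : ℝ) ^ (1 + α) := by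
      rw [← Real.rpow_natCast, ← Real.rpow_natCast, ← Real.rpow_add hX0, ← Real.rpow_add hX0, hKN]
      congr 1
      push_cast
      ring
    have hpow₂ : (n : ℝ) ^ ((K : ℝ) + 2 + α) = (n : ℝ) ^ N * (n : ℝ) * (n : ℝ) ^ (1 + α) := by
      rw [show (K : ℝ) + 2 + α = N + 1 + (1 + α) by rw [hKN]; ring, Real.rpow_add hX0,
        Real.rpow_add hX0, Real.rpow_natCast, Real.rpow_one]
    have h₁ := hD₁ n
    have h₂ := hD₂ n
    have h₃ := hD₃ n
    simp only [hpow₃] at h₁ h₂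
    simp only [hpow₂] at h₃
    have hΦ_le : ∀ s ∈ Set.Icc (-τ) 0, |Φ n s| ≤ ⨆ s ∈ Set.Icc (-τ) (0 : ℝ), |Φ n s| :=
      fun s hs => abs_le_biSup_of_continuousOn (hΦ n).continuousOn hs
    have hF_le : ∀ s ∈ Set.Icc 0 T, |F n s| ≤ ⨆ s ∈ Set.Icc (0 : ℝ) T, |F n s| :=
      fun s hs => abs_le_biSup_of_continuousOn (hF n) hs
    set φ := ⨆ s ∈ Set.Icc (-τ) (0 : ℝ), |Φ n s|
    set f := ⨆ s ∈ Set.Icc (0 : ℝ) T, |F n s|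
    set Y := (n : ℝ) ^ (1 + α)
    set P := (n : ℝ) ^ N
    have hP : 0 < P := by positivity
    have hφ : 0 ≤ φ := (abs_nonneg _).trans (hΦ_le 0 ⟨by linarith, le_rfl⟩)
    have hf : 0 ≤ f := (abs_nonneg _).trans (hF_le 0 ⟨le_rfl, hT0⟩)
    have hA_le : |A n t| * Y ≤ M * D₁ := by
      have hA' : |A n t| ≤ M * P * (|Φ n 0| + |derivWithin (Φ n) (Set.Icc (-τ) (0 : ℝ)) 0|) := by
        rw [hA, mul_add]
        refine (abs_add_le _ _).trans ?_
        rw [abs_mul, abs_mul]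
        gcongr
        · exact (hdel n hn t ht.2).1
        · exact (hdel n hn t ht.2).2
      calc |A n t| * Y
          ≤ M * P * (|Φ n 0| + |derivWithin (Φ n) (Set.Icc (-τ) (0 : ℝ)) 0|) * Y := by gcongr
        _ = M * ((|Φ n 0| + |derivWithin (Φ n) (Set.Icc (-τ) (0 : ℝ)) 0|) * (P * 1 * Y)) := by ring
        _ ≤ M * ((|Φ n 0| + |derivWithin (Φ n) (Set.Icc (-τ) (0 : ℝ)) 0|)
              * (P * (n : ℝ) ^ 2 * Y)) := by
            gcongr
            exact one_le_pow₀ hX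
        _ ≤ M * D₁ := by gcongr
    have hB_le : |B n t| * Y ≤ c₂ * M * τ * D₂ := by
      have hint : ‖∫ s in (-τ)..(0 : ℝ), Sdel τ (-(ω n) ^ 2) (-(υ n) ^ 2) (t - τ - s) * Φ n s‖
          ≤ M * P * φ * |0 - -τ| :=
        intervalIntegral.norm_integral_le_of_norm_le_const fun s hs => by
          rw [Set.uIoc_of_le (by linarith)] at hs
          rw [norm_mul, Real.norm_eq_abs, Real.norm_eq_abs]
          gcongr
          · exact (hdel n hn _ (by linarith [ht.2, hs.1])).2
          · exact hΦ_le s ⟨hs.1.le, hs.2⟩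
      rw [Real.norm_eq_abs, zero_sub, neg_neg, abs_of_pos hτ] at hint
      calc |B n t| * Y ≤ c₂ * (n : ℝ) ^ 2 * (M * P * φ * τ) * Y := by
            rw [hB, abs_mul, abs_neg, abs_of_nonneg (sq_nonneg _)]
            gcongr
            exact hυ_le n hn
        _ = c₂ * M * τ * (φ * (P * (n : ℝ) ^ 2 * Y)) := by ring
        _ ≤ c₂ * M * τ * D₂ := by gcongr
    have hC_le : |C n t| * Y ≤ M * T * D₃ := by
      have hint : ‖∫ s in (0 : ℝ)..t, Sdel τ (-(ω n) ^ 2) (-(υ n) ^ 2) (t - s) * F n s‖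
          ≤ M * P * f * |t - 0| :=
        intervalIntegral.norm_integral_le_of_norm_le_const fun s hs => by
          rw [Set.uIoc_of_le ht.1] at hs
          rw [norm_mul, Real.norm_eq_abs, Real.norm_eq_abs]
          gcongr
          · exact (hdel n hn _ (by linarith [ht.2, hs.1])).2
          · exact hF_le s ⟨hs.1.le, hs.2.trans ht.2⟩
      rw [Real.norm_eq_abs, sub_zero, abs_of_nonneg ht.1] at hint
      calc |C n t| * Y ≤ M * P * f * T * Y := by
            rw [hC]
            gcongr
            exact hint.trans (by gcongr; exact ht.2)
        _ = M * T * (f * (P * 1 * Y)) := by ring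
        _ ≤ M * T * (f * (P * n * Y)) := by gcongr
        _ ≤ M * T * D₃ := by gcongr
    rw [← div_eq_mul_inv, le_div_iff₀ hY]
    calc |A n t + B n t + C n t| * Y ≤ (|A n t| + |B n t| + |C n t|) * Y := by
          gcongr
          exact abs_add_three _ _ _
      _ = |A n t| * Y + |B n t| * Y + |C n t| * Y := by ring
      _ ≤ G := by simp only [G]; gcongr
  have hsum : Summable fun n : ℕ => G * (((n + 1 : ℕ) : ℝ) ^ (1 + α))⁻¹ :=
    ((summable_nat_add_iff 1).2 (Real.summable_nat_rpow_inv.2 (by linarith))).mul_left G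
  have hterm : ∀ (n : ℕ) (p : ℝ × ℝ), p ∈ Set.Icc (0 : ℝ) T ×ˢ Set.Icc (0 : ℝ) L →
      ‖(A (n + 1) p.1 + B (n + 1) p.1 + C (n + 1) p.1)
          * Real.sin (((n : ℝ) + 1) * Real.pi * p.2 / L)‖
        ≤ G * (((n + 1 : ℕ) : ℝ) ^ (1 + α))⁻¹ := fun n p hp => by
    rw [norm_mul, Real.norm_eq_abs, Real.norm_eq_abs]
    exact (mul_le_of_le_one_right (abs_nonneg _) (Real.abs_sin_le_one _)).trans
      (hcoef (n + 1) n.succ_pos p.1 hp.1)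
  exact ⟨fun p hp => Summable.of_nonneg_of_le (fun n => abs_nonneg _) (fun n => hterm n p hp) hsum,
    tendstoUniformlyOn_tsum_nat hsum hterm⟩
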